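/- Let c > 0, and let u : ℕ → ℝ → ℝ be a family of twice continuously differentiable functions such that for every n ≥ 1 and every t ≥ 0, uₙ''(t) − c² (uₙ₊₁(t) − 2uₙ(t) + uₙ₋₁(t)) + sin(uₙ(t)) = 0 (the undamped, unbiased chain, α = β = γ = 0), with initial conditions uₙ(0) = 0 for all n ≥ 0 and uₙ'(0) = 0 for all n ≥ 1. Assume that for each t ≥ 0 the sequence (uₙ'(t))ₙ≥₀ is square-summable, the series Σₙ≥₁ Hₙ(t) converges absolutely, and the series of derivatives Σₙ≥₁ Hₙ'(t) converges uniformly on compact subintervals of [0,∞). Then for every t ≥ 0 the total energy satisfies E(t) = −c² ∫₀ᵗ u₀'(s) (u₁(s) − u₀(s)) ds. -/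

import Mathlib

open Real Filter

/-- Local energy of the `n`-th site of the undamped, unbiased discrete
sine-Gordon chain with coupling `c`:
`Hₙ(t) = (1/2) uₙ'(t)² + (c²/2)(uₙ₊₁(t) − uₙ(t))² + 1 − cos(uₙ(t))`. -/
noncomputable def localE (c : ℝ) (u : ℕ → ℝ → ℝ) (n : ℕ) (t : ℝ) : ℝ :=
  (1 / 2) * (deriv (u n) t) ^ 2 + (c ^ 2 / 2) * (u (n + 1) t - u n t) ^ 2
    + (1 - Real.cos (u n t))

/-- Total energy of the chain:
`E(t) = Σₙ≥₁ Hₙ(t) + (c²/2)(u₁(t) − u₀(t))²`. -/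
noncomputable def totalE (c : ℝ) (u : ℕ → ℝ → ℝ) (t : ℝ) : ℝ :=
  (∑' n : ℕ, localE c u (n + 1) t) + (c ^ 2 / 2) * (u 1 t - u 0 t) ^ 2

theorem energy_integral_formula
    (c : ℝ) (hc : 0 < c)
    (u : ℕ → ℝ → ℝ) (hu : ∀ n, ContDiff ℝ 2 (u n))
    (heq : ∀ n : ℕ, ∀ t : ℝ, 0 ≤ t →
      deriv (deriv (u (n + 1))) t
        - c ^ 2 * (u (n + 2) t - 2 * u (n + 1) t + u n t)
        + Real.sin (u (n + 1) t) = 0)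
    (hinit : ∀ n : ℕ, u n 0 = 0)
    (hinit' : ∀ n : ℕ, deriv (u (n + 1)) 0 = 0)
    (hsq : ∀ t : ℝ, 0 ≤ t → Summable (fun n : ℕ => (deriv (u n) t) ^ 2))
    (habs : ∀ t : ℝ, 0 ≤ t → Summable (fun n : ℕ => |localE c u (n + 1) t|))
    (hunif : ∀ K : Set ℝ, IsCompact K → K ⊆ Set.Ici (0 : ℝ) →
      TendstoUniformlyOn
        (fun (N : ℕ) (t : ℝ) =>
          ∑ n ∈ Finset.range N, deriv (fun s => localE c u (n + 1) s) t)
        (fun t : ℝ => ∑' n : ℕ, deriv (fun s => localE c u (n + 1) s) t)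
        atTop K) :
    ∀ t : ℝ, 0 ≤ t →
      totalE c u t = -c ^ 2 * ∫ s in (0 : ℝ)..t, deriv (u 0) s * (u 1 s - u 0 s) := by
  have hd : ∀ n x, HasDerivAt (u n) (deriv (u n) x) x := fun n x =>
    ((hu n).differentiable (by norm_num) x).hasDerivAt
  have hC1 : ∀ n, ContDiff ℝ 1 (deriv (u n)) := fun n =>
    (contDiff_succ_iff_deriv (n := 1)).1 (by have h := hu n; rwa [show (2 : WithTop ℕ∞) = 1 + 1 by norm_num] at h) |>.2.2
  have hdd : ∀ n x, HasDerivAt (deriv (u n)) (deriv (deriv (u n)) x) x := fun n x =>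
    ((hC1 n).differentiable (by norm_num) x).hasDerivAt
  have hcu : ∀ n, Continuous (u n) := fun n => (hu n).continuous
  have hcd : ∀ n, Continuous (deriv (u n)) := fun n => (hC1 n).continuous
  have hH : ∀ n x, 0 ≤ x → HasDerivAt (fun s => localE c u (n + 1) s)
      (c ^ 2 * ((u (n + 2) x - u (n + 1) x) * deriv (u (n + 2)) x
        - (u (n + 1) x - u n x) * deriv (u (n + 1)) x)) x := by
    intro n x hx
    have h := ((((hdd (n + 1) x).pow 2).const_mul (1 / 2)).add
      ((((hd (n + 2) x).sub (hd (n + 1) x)).pow 2).const_mul (c ^ 2 / 2))).add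
      (((hd (n + 1) x).cos).const_sub 1)
    refine HasDerivAt.congr_deriv (f := fun s => localE c u (n + 1) s) h ?_
    have e := heq n x hx
    simp only [Pi.sub_apply, Nat.cast_ofNat]
    norm_num
    linear_combination (deriv (u (n + 1)) x) * e
  have hpart : ∀ N x, 0 ≤ x →
      ∑ n ∈ Finset.range N, deriv (fun s => localE c u (n + 1) s) x =
      c ^ 2 * ((u (N + 1) x - u N x) * deriv (u (N + 1)) x
        - (u 1 x - u 0 x) * deriv (u 1) x) := by
    intro N x hx
    induction N with
    | zero => simp
    | succ N ih =>
      rw [Finset.sum_range_succ, ih, (hH N x hx).deriv]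
      ring
  intro t ht
  have hmem : ∀ x ∈ Set.uIcc 0 t, 0 ≤ x := by
    intro x hx
    rw [Set.uIcc_of_le ht] at hx
    exact hx.1
  -- pointwise limit
  have hlim : ∀ x, 0 ≤ x →
      ∑' n : ℕ, deriv (fun s => localE c u (n + 1) s) x
        = -c ^ 2 * ((u 1 x - u 0 x) * deriv (u 1) x) := by
    intro x hx
    have h1 := (hunif {x} isCompact_singleton (by simpa using hx)).tendsto_at
      (Set.mem_singleton x)
    have hv2 : Tendsto (fun n => deriv (u n) x ^ 2) atTop (nhds 0) :=
      (hsq x hx).tendsto_atTop_zero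
    have hv2' : Tendsto (fun n => deriv (u (n + 1)) x ^ 2) atTop (nhds 0) :=
      hv2.comp (tendsto_add_atTop_nat 1)
    have hE : Tendsto (fun n => localE c u (n + 1) x) atTop (nhds 0) :=
      (habs x hx).of_abs.tendsto_atTop_zero
    have hE' : Tendsto (fun n => localE c u n x) atTop (nhds 0) :=
      (tendsto_add_atTop_iff_nat 1).1 hE
    have hprod : Tendsto (fun N => c ^ 2 * ((u (N + 1) x - u N x) * deriv (u (N + 1)) x))
        atTop (nhds 0) := by
      have hb : Tendsto (fun N => localE c u N x + c ^ 2 / 2 * deriv (u (N + 1)) x ^ 2)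
          atTop (nhds 0) := by
        simpa using hE'.add (hv2'.const_mul (c ^ 2 / 2))
      refine squeeze_zero_norm (fun N => ?_) hb
      rw [Real.norm_eq_abs, abs_le]
      unfold localE
      have h1 := Real.cos_le_one (u N x)
      have h2 := sq_nonneg (deriv (u N) x)
      have h3 := mul_nonneg (sq_nonneg c)
        (sq_nonneg ((u (N + 1) x - u N x) + deriv (u (N + 1)) x))
      have h4 := mul_nonneg (sq_nonneg c)
        (sq_nonneg ((u (N + 1) x - u N x) - deriv (u (N + 1)) x))
      constructor <;> nlinarith
    have h2 := hprod.sub_const (c ^ 2 * ((u 1 x - u 0 x) * deriv (u 1) x))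
    refine tendsto_nhds_unique h1 ?_
    convert h2 using 1
    · funext N
      rw [hpart N x hx]
      ring
    · congr 1
      ring
  have hcontN : ∀ N, ContinuousOn
      (fun x => ∑ n ∈ Finset.range N, deriv (fun s => localE c u (n + 1) s) x)
      (Set.uIcc 0 t) := by
    intro N
    have hc0 : Continuous (fun x => c ^ 2 * ((u (N + 1) x - u N x) * deriv (u (N + 1)) x
        - (u 1 x - u 0 x) * deriv (u 1) x)) := by fun_prop
    exact hc0.continuousOn.congr (fun x hx => hpart N x (hmem x hx))
  have hint := TendstoUniformlyOn.tendsto_intervalIntegral_of_continuousOn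
    (μ := MeasureTheory.volume) (Eventually.of_forall hcontN)
    (hunif (Set.uIcc 0 t) isCompact_uIcc (fun x hx => hmem x hx))
  have hz : ∀ n, localE c u (n + 1) 0 = 0 := by
    intro n
    simp [localE, hinit, hinit']
  have hFTC : ∀ N, ∫ x in (0 : ℝ)..t,
      ∑ n ∈ Finset.range N, deriv (fun s => localE c u (n + 1) s) x
      = ∑ n ∈ Finset.range N, localE c u (n + 1) t := by
    intro N
    rw [intervalIntegral.integral_eq_sub_of_hasDerivAt
      (f := fun x => ∑ n ∈ Finset.range N, localE c u (n + 1) x) _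
      (hcontN N).intervalIntegrable]
    · simp [hz]
    · intro x hx
      exact HasDerivAt.fun_sum fun n _ =>
        (hH n x (hmem x hx)).differentiableAt.hasDerivAt
  simp only [hFTC] at hint
  have hsum := tendsto_nhds_unique (habs t ht).of_abs.hasSum.tendsto_sum_nat hint
  rw [intervalIntegral.integral_congr (fun x hx => hlim x (hmem x hx))] at hsum
  have hbd : ∫ x in (0 : ℝ)..t,
      c ^ 2 * ((u 1 x - u 0 x) * (deriv (u 1) x - deriv (u 0) x))
      = c ^ 2 / 2 * (u 1 t - u 0 t) ^ 2 := by
    rw [intervalIntegral.integral_eq_sub_of_hasDerivAt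
      (f := fun x => c ^ 2 / 2 * (u 1 x - u 0 x) ^ 2) _
      (Continuous.intervalIntegrable (by fun_prop) _ _)]
    · simp [hinit]
    · intro x _
      refine ((((hd 1 x).sub (hd 0 x)).pow 2).const_mul (c ^ 2 / 2)).congr_deriv ?_
      simp only [Pi.sub_apply, Nat.cast_ofNat]
      norm_num
      ring
  unfold totalE
  rw [hsum, ← hbd, ← intervalIntegral.integral_add
    (Continuous.intervalIntegrable (by fun_prop) _ _)
    (Continuous.intervalIntegrable (by fun_prop) _ _),
    ← intervalIntegral.integral_const_mul]
  refine intervalIntegral.integral_congr fun x _ => ?_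
  ring
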